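/- Dimensional commutation property for the heat semigroup: let (T_t) be the heat semigroup on ℝⁿ (generator Δ/2). Then for every ε > 0, all s, t ≥ 0, and every bounded measurable f : ℝⁿ → ℝ, the pointwise inequality Q^ε_1(T_t f) ≤ T_s(Q^ε_1 f) + (n/2)(√t − √s)² holds on ℝⁿ. -/

import Mathlib

open MeasureTheory Real Filter Set
open scoped ENNReal Topology

noncomputable section

/-- The heat kernel on ℝⁿ for the generator `Δ/2`. -/
def heatKer (n : ℕ) (t : ℝ) (x y : EuclideanSpace ℝ (Fin n)) : ℝ :=
  (2 * π * t) ^ (-(n : ℝ) / 2) * Real.exp (-‖x - y‖ ^ 2 / (2 * t))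

/-- The heat semigroup on ℝⁿ with generator `Δ/2`, reversible with respect to `Leb`. -/
def heatT (n : ℕ) (t : ℝ) (f : EuclideanSpace ℝ (Fin n) → ℝ)
    (x : EuclideanSpace ℝ (Fin n)) : ℝ :=
  if t = 0 then f x else ∫ y, f y * heatKer n t x y

/-- The Hopf–Lax type semigroup `Q^ε_u ψ = ε log T_{εu}(e^{ψ/ε})` for the heat semigroup. -/
def heatQ (n : ℕ) (eps u : ℝ) (ψ : EuclideanSpace ℝ (Fin n) → ℝ)
    (x : EuclideanSpace ℝ (Fin n)) : ℝ :=
  eps * Real.log (heatT n (eps * u) (fun y => Real.exp (ψ y / eps)) x)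

open ProbabilityTheory
open scoped RealInnerProductSpace

/-- Convexity of the log-Laplace functional `F ↦ log ∫ e^F dν`, in the form of Jensen's inequality
with respect to a probability measure `μ`. -/
lemma log_integral_exp_integral_le {α β : Type*} [MeasurableSpace α] [MeasurableSpace β]
    (μ : Measure α) (ν : Measure β) [IsProbabilityMeasure μ] [IsProbabilityMeasure ν]
    (F : α → β → ℝ) (C : ℝ) (hF : Integrable (Function.uncurry F) (μ.prod ν))
    (hC : ∀ w, |∫ z, F z w ∂μ| ≤ C)
    (hexp : ∀ z, Integrable (fun w => Real.exp (F z w)) ν)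
    (hlog : Integrable (fun z => Real.log (∫ w, Real.exp (F z w) ∂ν)) μ) :
    Real.log (∫ w, Real.exp (∫ z, F z w ∂μ) ∂ν) ≤
      ∫ z, Real.log (∫ w, Real.exp (F z w) ∂ν) ∂μ := by
  set h : β → ℝ := fun w => ∫ z, F z w ∂μ with hh
  have hhm : AEStronglyMeasurable h ν := hF.integral_prod_right.aestronglyMeasurable
  have hhi : Integrable h ν := hF.integral_prod_right
  have hei : Integrable (fun w => Real.exp (h w)) ν := by
    refine Integrable.of_bound (Real.continuous_exp.comp_aestronglyMeasurable hhm) (Real.exp C)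
      (ae_of_all _ fun w => ?_)
    rw [Real.norm_eq_abs, Real.abs_exp]
    exact Real.exp_le_exp.2 ((le_abs_self _).trans (hC w))
  set L := Real.log (∫ w, Real.exp (h w) ∂ν) with hL
  have hLexp : Real.exp L = ∫ w, Real.exp (h w) ∂ν := Real.exp_log (integral_exp_pos hei)
  set p : β → ℝ := fun w => Real.exp (h w - L) with hp
  have hpm : AEStronglyMeasurable p ν :=
    Real.continuous_exp.comp_aestronglyMeasurable (hhm.sub aestronglyMeasurable_const)
  have hpb : ∀ w, ‖p w‖ ≤ Real.exp (C - L) := fun w => by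
    rw [Real.norm_eq_abs, Real.abs_exp]
    exact Real.exp_le_exp.2 (sub_le_sub_right ((le_abs_self _).trans (hC w)) _)
  have hpi : Integrable p ν := Integrable.of_bound hpm _ (ae_of_all _ hpb)
  have hp1 : ∫ w, p w ∂ν = 1 := by
    simp only [hp, Real.exp_sub, integral_div]
    rw [← hLexp, div_self (Real.exp_pos L).ne']
  have hG : Integrable (Function.uncurry fun z w => p w * (F z w - h w)) (μ.prod ν) := by
    refine Integrable.bdd_mul (c := Real.exp (C - L)) (hF.sub (hhi.comp_snd μ)) hpm.comp_snd
      (ae_of_all _ fun x => hpb x.2)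
  have key : ∀ᵐ z ∂μ, L + ∫ w, p w * (F z w - h w) ∂ν ≤ Real.log (∫ w, Real.exp (F z w) ∂ν) := by
    filter_upwards [hG.prod_right_ae] with z hz
    have hz' : Integrable (fun w => p w * (F z w - h w)) ν := hz
    set M := Real.log (∫ w, Real.exp (F z w) ∂ν) with hM
    have hMexp : Real.exp M = ∫ w, Real.exp (F z w) ∂ν := Real.exp_log (integral_exp_pos (hexp z))
    have h1 : ∫ w, Real.exp (F z w - M) ∂ν = 1 := by
      simp only [Real.exp_sub, integral_div]
      rw [← hMexp, div_self (Real.exp_pos M).ne']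
    have h2 : ∫ w, (p w * (1 + L - M) + p w * (F z w - h w)) ∂ν ≤
        ∫ w, Real.exp (F z w - M) ∂ν := by
      refine integral_mono ((hpi.mul_const _).add hz') ?_ fun w => ?_
      · simp only [Real.exp_sub]
        exact (hexp z).div_const _
      · have := Real.add_one_le_exp (F z w - M - (h w - L))
        have h3 : Real.exp (F z w - M) = p w * Real.exp (F z w - M - (h w - L)) := by
          rw [hp, ← Real.exp_add]; congr 1; ring
        simp only
        rw [h3, ← mul_add]
        exact mul_le_mul_of_nonneg_left (by linarith) (Real.exp_pos _).le
    rw [integral_add (hpi.mul_const _) hz', integral_mul_const, hp1, h1] at h2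
    linarith
  have hzero : ∫ z, ∫ w, p w * (F z w - h w) ∂ν ∂μ = 0 := by
    rw [integral_integral_swap hG]
    refine integral_eq_zero_of_ae ?_
    filter_upwards [hF.prod_left_ae] with w hw
    have hw' : Integrable (fun z => F z w) μ := hw
    rw [integral_const_mul, integral_sub hw' (integrable_const _)]
    simp [hh]
  have hGi : Integrable (fun z => ∫ w, p w * (F z w - h w) ∂ν) μ := hG.integral_prod_left
  have := integral_mono_ae ((integrable_const L).add hGi) hlog key
  simp only [Pi.add_apply] at this
  rw [integral_add (integrable_const L) hGi, hzero] at this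
  simpa using this

lemma heatKer_nonneg (n : ℕ) {t : ℝ} (ht : 0 ≤ t) (x y : EuclideanSpace ℝ (Fin n)) :
    0 ≤ heatKer n t x y := by
  unfold heatKer; positivity

lemma continuous_heatKer (n : ℕ) (t : ℝ) (x : EuclideanSpace ℝ (Fin n)) :
    Continuous (heatKer n t x) := by
  unfold heatKer; fun_prop

lemma integrable_heatKer_one (n : ℕ) :
    Integrable (heatKer n 1 (0 : EuclideanSpace ℝ (Fin n))) := by
  have := (GaussianFourier.integrable_cexp_neg_mul_sq_norm_add (V := EuclideanSpace ℝ (Fin n))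
    (b := 1 / 2) (by norm_num) 0 0).norm.const_mul ((2 * π) ^ (-(n : ℝ) / 2))
  refine this.congr (ae_of_all _ fun y => ?_)
  simp only [heatKer, Complex.norm_exp, zero_sub, norm_neg]
  congr 2
  · ring
  · norm_num
    norm_cast
    ring

lemma withDensity_heatKer_one (n : ℕ) :
    (volume : Measure (EuclideanSpace ℝ (Fin n))).withDensity
      (fun y => ENNReal.ofReal (heatKer n 1 0 y)) = stdGaussian (EuclideanSpace ℝ (Fin n)) := by
  have hfin : IsFiniteMeasure ((volume : Measure (EuclideanSpace ℝ (Fin n))).withDensity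
      (fun y => ENNReal.ofReal (heatKer n 1 0 y))) :=
    isFiniteMeasure_withDensity_ofReal (integrable_heatKer_one n).2
  refine Measure.ext_of_charFun (funext fun v => ?_)
  rw [charFun_stdGaussian, charFun_apply, integral_withDensity_eq_integral_toReal_smul
    (continuous_heatKer n 1 0).measurable.ennreal_ofReal (ae_of_all _ fun _ => ENNReal.ofReal_lt_top)]
  have h1 := GaussianFourier.integral_cexp_neg_mul_sq_norm_add (V := EuclideanSpace ℝ (Fin n))
    (b := 1 / 2) (by norm_num) Complex.I v
  have h2 : ∀ y : EuclideanSpace ℝ (Fin n), (ENNReal.ofReal (heatKer n 1 0 y)).toReal •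
      Complex.exp (⟪y, v⟫ * Complex.I) = (((2 * π) ^ (-(n : ℝ) / 2) : ℝ) : ℂ) *
        Complex.exp (-(1 / 2) * ‖y‖ ^ 2 + Complex.I * ⟪v, y⟫) := fun y => by
    rw [ENNReal.toReal_ofReal (heatKer_nonneg n zero_le_one 0 y), heatKer, Complex.real_smul,
      Complex.exp_add, real_inner_comm]
    push_cast
    rw [zero_sub, norm_neg, mul_comm Complex.I, mul_assoc, mul_one]
    congr 3
    ring
  simp_rw [h2]
  rw [integral_const_mul, h1, ← mul_assoc]
  have h3 : (((2 * π) ^ (-(n : ℝ) / 2) : ℝ) : ℂ) *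
      ((π : ℂ) / (1 / 2)) ^ ((Module.finrank ℝ (EuclideanSpace ℝ (Fin n)) : ℂ) / 2) = 1 := by
    rw [finrank_euclideanSpace_fin, show (π : ℂ) / (1 / 2) = ((2 * π : ℝ) : ℂ) by
      push_cast; ring, show (n : ℂ) / 2 = ((n / 2 : ℝ) : ℂ) by push_cast; ring,
      ← Complex.ofReal_cpow (by positivity), ← Complex.ofReal_mul,
      ← Real.rpow_add (by positivity)]
    norm_num
    ring_nf
    simp
  rw [h3, one_mul, Complex.I_sq]
  congr 1
  ring

lemma integral_stdGaussian_eq (n : ℕ) (g : EuclideanSpace ℝ (Fin n) → ℝ) :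
    ∫ y, g y ∂(stdGaussian (EuclideanSpace ℝ (Fin n))) = ∫ y, g y * heatKer n 1 0 y := by
  rw [← withDensity_heatKer_one, integral_withDensity_eq_integral_toReal_smul
    (continuous_heatKer n 1 0).measurable.ennreal_ofReal (ae_of_all _ fun _ => ENNReal.ofReal_lt_top)]
  refine integral_congr_ae (ae_of_all _ fun y => ?_)
  simp only [smul_eq_mul]
  rw [ENNReal.toReal_ofReal (heatKer_nonneg n zero_le_one 0 y), mul_comm]

/-- The Cameron–Martin formula for the standard Gaussian measure. -/
lemma integral_stdGaussian_eq_integral_add (n : ℕ) (g : EuclideanSpace ℝ (Fin n) → ℝ)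
    (v : EuclideanSpace ℝ (Fin n)) :
    ∫ y, g y ∂(stdGaussian (EuclideanSpace ℝ (Fin n))) =
      ∫ y, g (y + v) * Real.exp (-⟪y, v⟫ - ‖v‖ ^ 2 / 2)
        ∂(stdGaussian (EuclideanSpace ℝ (Fin n))) := by
  rw [integral_stdGaussian_eq, integral_stdGaussian_eq, ← integral_add_right_eq_self _ v]
  refine integral_congr_ae (ae_of_all _ fun y => ?_)
  simp only [heatKer, zero_sub, norm_neg]
  rw [mul_assoc (g _), mul_left_comm (Real.exp _), ← Real.exp_add, norm_add_sq_real]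
  congr 3
  ring

/-- Mehler-type representation of the heat semigroup through the standard Gaussian measure. -/
lemma heatT_eq_integral_stdGaussian (n : ℕ) {t : ℝ} (ht : 0 ≤ t)
    (f : EuclideanSpace ℝ (Fin n) → ℝ) (x : EuclideanSpace ℝ (Fin n)) :
    heatT n t f x =
      ∫ z, f (x + √t • z) ∂(stdGaussian (EuclideanSpace ℝ (Fin n))) := by
  unfold heatT
  split_ifs with h0
  · simp [h0]
  have hpos : 0 < t := lt_of_le_of_ne ht (Ne.symm h0)
  have hsq : 0 < √t := Real.sqrt_pos.2 hpos
  rw [integral_stdGaussian_eq, ← integral_add_left_eq_self _ x]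
  have h1 := Measure.integral_comp_smul (volume : Measure (EuclideanSpace ℝ (Fin n)))
    (fun y => f (x + y) * heatKer n t x (x + y)) √t
  rw [finrank_euclideanSpace_fin, abs_of_pos (by positivity), smul_eq_mul, inv_mul_eq_div,
    eq_div_iff (by positivity), ← integral_mul_const] at h1
  rw [← h1]
  refine integral_congr_ae (ae_of_all _ fun y => ?_)
  simp only [heatKer, zero_sub, norm_neg, sub_add_cancel_left, norm_smul, Real.norm_eq_abs,
    mul_pow, sq_abs, Real.sq_sqrt ht]
  have h2 : (2 * π * t) ^ (-(n : ℝ) / 2) * √t ^ n = (2 * π * 1) ^ (-(n : ℝ) / 2) := by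
    rw [Real.mul_rpow (by positivity) ht, mul_assoc, Real.sqrt_eq_rpow, ← Real.rpow_mul_natCast ht,
      ← Real.rpow_add hpos, mul_one]
    ring_nf
    simp
  rw [← h2, show -(t * ‖y‖ ^ 2) / (2 * t) = -‖y‖ ^ 2 / (2 * 1) by field_simp]
  ring

lemma integrable_norm_sq_stdGaussian (n : ℕ) :
    Integrable (fun z => ‖z‖ ^ 2) (stdGaussian (EuclideanSpace ℝ (Fin n))) :=
  (IsGaussian.memLp_two_id (μ := stdGaussian (EuclideanSpace ℝ (Fin n)))).integrable_norm_pow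
    two_ne_zero

lemma integral_norm_sq_stdGaussian (n : ℕ) :
    ∫ z, ‖z‖ ^ 2 ∂(stdGaussian (EuclideanSpace ℝ (Fin n))) = n := by
  have hcoord : ∀ i, ∫ z, (z i) ^ 2 ∂(stdGaussian (EuclideanSpace ℝ (Fin n))) = 1 := fun i => by
    have h1 := variance_dual_stdGaussian (innerSL ℝ (EuclideanSpace.single i (1 : ℝ)))
    rw [variance_of_integral_eq_zero (ContinuousLinearMap.continuous _).aemeasurable
      (integral_strongDual_stdGaussian _), innerSL_apply_norm] at h1
    simpa [EuclideanSpace.inner_single_left] using h1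
  simp_rw [EuclideanSpace.real_norm_sq_eq]
  rw [integral_finsetSum]
  · simp [hcoord]
  · intro i _
    refine (integrable_norm_sq_stdGaussian n).mono (by fun_prop) (ae_of_all _ fun z => ?_)
    rw [norm_pow, norm_pow, norm_norm]
    exact pow_le_pow_left₀ (norm_nonneg _) (PiLp.norm_apply_le z i) 2

lemma integral_inner_stdGaussian (n : ℕ) (u : EuclideanSpace ℝ (Fin n)) :
    ∫ z, ⟪u, z⟫ ∂(stdGaussian (EuclideanSpace ℝ (Fin n))) = 0 :=
  integral_strongDual_stdGaussian (innerSL ℝ u)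

lemma measurabheatT_mem_bounds (n : ℕ) {t : ℝ} (ht : 0 ≤ t)
    {f : EuclideanSpace ℝ (Fin n) → ℝ}
    (hf : Measurable f) : Measurable (heatT n t f) := by
  rw [funext (heatT_eq_integral_stdGaussian n ht f)]
  have : StronglyMeasurable (fun q : EuclideanSpace ℝ (Fin n) × EuclideanSpace ℝ (Fin n) =>
      f (q.1 + √t • q.2)) := (hf.comp (by fun_prop)).stronglyMeasurable
  exact this.integral_prod_right.measurable

lemma heatT_mem_bounds (n : ℕ) {t : ℝ} (ht : 0 ≤ t)
    {f : EuclideanSpace ℝ (Fin n) → ℝ}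
    (hf : Measurable f) {a b : ℝ} (ha : ∀ x, a ≤ f x) (hb : ∀ x, f x ≤ b)
    (x : EuclideanSpace ℝ (Fin n)) : a ≤ heatT n t f x ∧ heatT n t f x ≤ b := by
  rw [heatT_eq_integral_stdGaussian n ht]
  have hi : Integrable (fun z => f (x + √t • z)) (stdGaussian (EuclideanSpace ℝ (Fin n))) := by
    refine Integrable.of_bound (hf.comp (by fun_prop)).aestronglyMeasurable (max |a| |b|)
      (ae_of_all _ fun z => ?_)
    exact abs_le_max_abs_abs (ha _) (hb _)
  constructor
  · simpa using integral_mono (integrable_const a) hi fun z => ha _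
  · simpa using integral_mono hi (integrable_const b) fun z => hb _

/-- **Dimensional commutation property for the heat semigroup** (Lemma `el-comm` (b)):
`Q^ε_1(T_t f) ≤ T_s(Q^ε_1 f) + (n/2)(√t − √s)²` pointwise. -/
theorem heat_commutation_dimensional (n : ℕ) (hn : 0 < n)
    (eps : ℝ) (heps : 0 < eps) (s t : ℝ) (hs : 0 ≤ s) (ht : 0 ≤ t)
    (f : EuclideanSpace ℝ (Fin n) → ℝ) (hf : Measurable f) (hfb : ∃ C : ℝ, ∀ x, |f x| ≤ C) :
    ∀ x, heatQ n eps 1 (heatT n t f) x ≤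
      heatT n s (heatQ n eps 1 f) x + (n : ℝ) / 2 * (Real.sqrt t - Real.sqrt s) ^ 2 := by
  intro x
  obtain ⟨C, hC⟩ := hfb
  set γ : Measure (EuclideanSpace ℝ (Fin n)) :=
    stdGaussian (EuclideanSpace ℝ (Fin n))
  set c : ℝ := (√t - √s) / √eps with hc
  have hse : 0 < √eps := Real.sqrt_pos.2 heps
  have hc2 : c ^ 2 = (√t - √s) ^ 2 / eps := by rw [hc, div_pow, Real.sq_sqrt heps.le]
  set F : EuclideanSpace ℝ (Fin n) → EuclideanSpace ℝ (Fin n) → ℝ := fun z u =>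
    f (x + √eps • u + √t • z) / eps - (c * ⟪u, z⟫ + c ^ 2 / 2 * ‖z‖ ^ 2) with hFdef
  have hlow : ∀ y, Real.exp (-C / eps) ≤ Real.exp (f y / eps) := fun y =>
    Real.exp_le_exp.2 (div_le_div_of_nonneg_right (abs_le.1 (hC y)).1 heps.le)
  have hupp : ∀ y, Real.exp (f y / eps) ≤ Real.exp (C / eps) := fun y =>
    Real.exp_le_exp.2 (div_le_div_of_nonneg_right (abs_le.1 (hC y)).2 heps.le)
  have hexpm : Measurable fun y => Real.exp (f y / eps) := (hf.div_const eps).exp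
  have hshift : ∀ z, ∫ u, Real.exp (F z u) ∂γ =
      heatT n eps (fun y => Real.exp (f y / eps)) (x + √s • z) := fun z => by
    rw [heatT_eq_integral_stdGaussian n heps.le, integral_stdGaussian_eq_integral_add n
      (fun u => Real.exp (f (x + √s • z + √eps • u) / eps)) (c • z)]
    refine integral_congr_ae (ae_of_all _ fun u => ?_)
    simp only [hFdef]
    rw [← Real.exp_add, smul_add, smul_smul, hc, mul_div_cancel₀ _ hse.ne', ← hc,
      show x + √s • z + (√eps • u + (√t - √s) • z) = x + √eps • u + √t • z by
        rw [sub_smul]; abel, inner_smul_right, norm_smul, mul_pow, Real.norm_eq_abs, sq_abs]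
    congr 1
    ring
  have hn2 := integrable_norm_sq_stdGaussian n
  have hfi : ∀ u, Integrable (fun z => f (x + √eps • u + √t • z) / eps) γ := fun u =>
    (Integrable.of_bound (hf.comp (by fun_prop)).aestronglyMeasurable C
      (ae_of_all _ fun z => hC _)).div_const _
  have hini : ∀ u : EuclideanSpace ℝ (Fin n), Integrable (fun z => ⟪u, z⟫) γ := fun u =>
    (innerSL ℝ u).integrable_comp IsGaussian.integrable_id
  have hmean : ∀ u, ∫ z, F z u ∂γ = heatT n t f (x + √eps • u) / eps - c ^ 2 / 2 * n := fun u => by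
    simp only [hFdef]
    have hq : Integrable (fun z => c * ⟪u, z⟫ + c ^ 2 / 2 * ‖z‖ ^ 2) γ :=
      ((hini u).const_mul c).add (hn2.const_mul _)
    rw [integral_sub (hfi u) hq,
      integral_add ((hini u).const_mul c) (hn2.const_mul _), integral_const_mul,
      integral_const_mul, integral_inner_stdGaussian, integral_norm_sq_stdGaussian,
      integral_div, heatT_eq_integral_stdGaussian n ht]
    ring
  have hTb : ∀ y, |heatT n t f y| ≤ C := fun y => abs_le.2
    (heatT_mem_bounds n ht hf (fun y => (abs_le.1 (hC y)).1) (fun y => (abs_le.1 (hC y)).2) y)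
  have hFint : Integrable (Function.uncurry F) (γ.prod γ) := by
    refine Integrable.sub (Integrable.div_const (Integrable.of_bound
      (hf.comp (by fun_prop)).aestronglyMeasurable C (ae_of_all _ fun q => hC _)) _)
      (Integrable.add (Integrable.const_mul ?_ _) ((hn2.comp_fst γ).const_mul _))
    refine Integrable.mono ((hn2.comp_fst γ).add (hn2.comp_snd γ)) (by fun_prop)
      (ae_of_all _ fun q => ?_)
    rw [Pi.add_apply, Real.norm_of_nonneg (by positivity : 0 ≤ ‖q.1‖ ^ 2 + ‖q.2‖ ^ 2)]
    refine (norm_inner_le_norm _ _).trans ?_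
    nlinarith [sq_nonneg (‖q.1‖ - ‖q.2‖), sq_nonneg ‖q.1‖, sq_nonneg ‖q.2‖]
  have hlogb : ∀ y, |Real.log (heatT n eps (fun y => Real.exp (f y / eps)) y)| ≤ C / eps :=
    fun y => by
      obtain ⟨h1, h2⟩ := heatT_mem_bounds n heps.le hexpm hlow hupp y
      have hp := (Real.exp_pos _).trans_le h1
      rw [abs_le, ← neg_div]
      exact ⟨(Real.le_log_iff_exp_le hp).2 h1, (Real.log_le_iff_le_exp hp).2 h2⟩
  have hlogm : Measurable fun z =>
      Real.log (heatT n eps (fun y => Real.exp (f y / eps)) (x + √s • z)) :=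
    ((measurabheatT_mem_bounds n heps.le hexpm).comp (by fun_prop)).log
  have key := log_integral_exp_integral_le γ γ F (C / eps + c ^ 2 / 2 * n) hFint ?_ ?_ ?_
  · simp only [heatQ, mul_one]
    rw [heatT_eq_integral_stdGaussian n hs, heatT_eq_integral_stdGaussian n heps.le]
    simp_rw [hmean, hshift, Real.exp_sub] at key
    rw [integral_div, Real.log_div ?_ (Real.exp_pos _).ne', Real.log_exp, hc2] at key
    · simp only [heatQ, mul_one, integral_const_mul]
      have := mul_le_mul_of_nonneg_left key heps.le
      rw [mul_sub] at this
      have h3 : eps * ((√t - √s) ^ 2 / eps / 2 * n) = n / 2 * (√t - √s) ^ 2 := by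
        field_simp
      linarith
    · refine (integral_exp_pos (μ := γ) ?_).ne'
      refine Integrable.of_bound (((measurabheatT_mem_bounds n ht hf).comp
        (by fun_prop)).div_const _).exp.aestronglyMeasurable (Real.exp (C / eps))
        (ae_of_all _ fun u => ?_)
      rw [Real.norm_eq_abs, Real.abs_exp]
      exact Real.exp_le_exp.2
        (div_le_div_of_nonneg_right ((le_abs_self _).trans (hTb _)) heps.le)
  · intro u
    rw [hmean]
    refine (abs_sub _ _).trans (add_le_add ?_ (abs_of_nonneg (by positivity)).le)
    rw [abs_div, abs_of_pos heps]
    exact div_le_div_of_nonneg_right (hTb _) heps.le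
  · intro z
    refine Integrable.of_integral_ne_zero ?_
    rw [hshift]
    exact ((Real.exp_pos _).trans_le (heatT_mem_bounds n heps.le hexpm hlow hupp _).1).ne'
  · simp_rw [hshift]
    exact Integrable.of_bound hlogm.aestronglyMeasurable _ (ae_of_all _ fun z => hlogb _)
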